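/- Let A and B be small categories, suppose A has finite products, and let F : A ⥤ Psh(B) be a functor preserving finite products. Then the left Kan extension F* : Psh(A) ⥤ Psh(B) of F along the Yoneda embedding y_A preserves finite products. -/

import Mathlib

open CategoryTheory CategoryTheory.Limits

universe u

/-- The opposite of the category of elements of a finite-product-preserving functor is sifted. -/
instance isSifted_op_elements {A : Type u} [SmallCategory A] [HasFiniteProducts A]
    (G : A ⥤ Type u) [PreservesFiniteProducts G] : IsSifted G.Elementsᵒᵖ := by
  have : HasTerminal G.Elements :=
    inferInstanceAs (HasLimitsOfShape (Discrete PEmpty.{1}) G.Elements)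
  have : HasBinaryProducts G.Elements :=
    inferInstanceAs (HasLimitsOfShape (Discrete WalkingPair) G.Elements)
  have : Nonempty G.Elementsᵒᵖ := ⟨.op (⊤_ _)⟩
  infer_instance

/-- A cocontinuous functor on presheaves is the left Kan extension along the Yoneda embedding
of its restriction to representables. -/
lemma isLeftKanExtension_yoneda_of_preservesColimits {A : Type u} [SmallCategory A]
    {E : Type*} [Category.{u} E] [HasColimitsOfSize.{u, u} E] {G : A ⥤ E}
    (L : (Aᵒᵖ ⥤ Type u) ⥤ E) [PreservesColimitsOfSize.{u, u} L] (e : G ≅ yoneda ⋙ L) :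
    L.IsLeftKanExtension e.hom := by
  have := Presheaf.isLeftKanExtension_of_preservesColimits.{u} L
    (e ≪≫ Functor.isoWhiskerRight uliftYonedaIsoYoneda.{u}.symm L)
  rw [Functor.isLeftKanExtension_iff_postcomp₁ (𝟭 _)
    (Functor.rightUnitor _ ≪≫ uliftYonedaIsoYoneda.{u}.symm)] at this
  refine (Functor.isLeftKanExtension_iff_of_iso (L.leftUnitor) _ _ ?_).1 this
  ext X
  simp [← Functor.map_comp]

/-- The left Kan extension of `G : A ⥤ Type u` along the Yoneda embedding sends `P` to the colimit
of `P` over the opposite of the category of elements of `G`. -/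
noncomputable def yonedaLeftKanExtensionIsoColim {A : Type u} [SmallCategory A] (G : A ⥤ Type u) :
    yoneda.leftKanExtension G ≅
      (Functor.whiskeringLeft _ _ (Type u)).obj (CategoryOfElements.π G).op ⋙ colim :=
  let e : G ≅ yoneda ⋙
      (Functor.whiskeringLeft _ _ (Type u)).obj (CategoryOfElements.π G).op ⋙ colim :=
    (Functor.Elements.shrinkYonedaCompWhiskeringLeftObjπCompColimIso G).symm ≪≫
      Functor.isoWhiskerRight shrinkYonedaIsoYoneda _
  have := isLeftKanExtension_yoneda_of_preservesColimits _ e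
  Functor.leftKanExtensionUnique _ (yoneda.leftKanExtensionUnit G) _ e.hom

/-- Let `A`, `B` be small categories, with `A` having finite products, and let
`F : A ⥤ Psh(B)` preserve finite products. Then the left Kan extension
`F* : Psh(A) ⥤ Psh(B)` of `F` along the Yoneda embedding preserves finite products. -/
theorem leftKanExtension_along_yoneda_preservesFiniteProducts
    (A B : Type u) [SmallCategory A] [SmallCategory B] [HasFiniteProducts A]
    (F : A ⥤ Bᵒᵖ ⥤ Type u) [PreservesFiniteProducts F] :
    PreservesFiniteProducts (yoneda.leftKanExtension F) where
  preserves n := by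
    refine preservesLimitsOfShape_of_evaluation _ _ fun b ↦ ?_
    have : PreservesFiniteProducts (F ⋙ (evaluation _ _).obj b) := by infer_instance
    exact preservesLimitsOfShape_of_natIso
      (Functor.leftKanExtensionCompIsoOfPreserves ((evaluation _ _).obj b) F yoneda ≪≫
        yonedaLeftKanExtensionIsoColim _).symm
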